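/- arXiv:1108.4192 — 2 statements merged into one kernel-verified Lean document; each statement's English description precedes it below -/
import Mathlib

section
/- Let Γ be a countably infinite group and f ∈ ℤΓ well-balanced; let μ ∈ ℝΓ be given by μ_e = 0 and μ_s = −f_s/f_e for s ≠ e, assume Σ_{k=0}^∞ ‖μ^k‖_∞ < ∞, and set ω_s = f_e^{-1} Σ_{k=0}^∞ (μ^k)_s. Then the homoclinic group of X_f equals Q(ℤΓω): a point x ∈ X_f satisfies x_g → 0 in ℝ/ℤ along the cofinite filter on Γ if and only if there exists h ∈ ℤΓ with x = Q(hω), where (hω)_w = Σ_{s∈Γ} h_s ω_{s⁻¹w} (a finite sum over the support of h). Moreover every point of the form Q(hω) with h ∈ ℤΓ lies in X_f and is homoclinic. -/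
open Filter Topology
open scoped Classical

noncomputable section

/-- `f ∈ ℤΓ` is well-balanced: finitely supported, coefficients sum to `0`,
nonpositive off the identity, symmetric, and with support generating `Γ`. -/
def WellBalancedZ {G : Type*} [Group G] (f : G → ℤ) : Prop :=
  (Function.support f).Finite ∧ (∑ᶠ s : G, f s) = 0 ∧
    (∀ s : G, s ≠ 1 → f s ≤ 0) ∧ (∀ s : G, f s⁻¹ = f s) ∧
    Subgroup.closure (Function.support f) = ⊤

/-- `X_f = {x ∈ (ℝ/ℤ)^Γ : ∀ t, ∑_s f_s · x_{ts} = 0}`. -/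
def XfSet {G : Type*} [Group G] (f : G → ℤ) : Set (G → UnitAddCircle) :=
  {x | ∀ t : G, (∑ᶠ s : G, f s • x (t * s)) = 0}

/-- Convolution `(uv)_w = ∑_s u_s v_{s⁻¹ w}` in `ℝΓ`. -/
def convR {G : Type*} [Group G] (u v : G → ℝ) : G → ℝ :=
  fun w => ∑ᶠ s : G, u s * v (s⁻¹ * w)

/-- Convolution powers `u^k` in `ℝΓ`, with `u^0 = δ_e`. -/
def convPow {G : Type*} [Group G] (u : G → ℝ) : ℕ → G → ℝ
  | 0 => fun s => if s = 1 then 1 else 0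
  | k + 1 => convR u (convPow u k)

/-- `μ ∈ ℝΓ` associated to a well-balanced `f`: `μ_e = 0`, `μ_s = -f_s/f_e` for `s ≠ e`. -/
def muOf {G : Type*} [Group G] (f : G → ℝ) : G → ℝ :=
  fun s => if s = 1 then 0 else -(f s) / f 1

/-- `ω_s = f_e⁻¹ ∑_{k≥0} (μ^k)_s`. -/
def omegaOf {G : Type*} [Group G] (f : G → ℝ) : G → ℝ :=
  fun s => (f 1)⁻¹ * ∑' k : ℕ, convPow (muOf f) k s

/-- The element `ω` associated to a well-balanced `f ∈ ℤΓ`. -/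
def omegaOfZ {G : Type*} [Group G] (f : G → ℤ) : G → ℝ :=
  omegaOf (fun s => (f s : ℝ))

/-- `Q(hω) ∈ (ℝ/ℤ)^Γ` : the coordinatewise reduction mod `ℤ` of the convolution `hω`,
for `h ∈ ℤΓ`, where `(hω)_w = ∑_s h_s ω_{s⁻¹ w}`. -/
def homPt {G : Type*} [Group G] (f : G → ℤ) (h : G → ℤ) : G → UnitAddCircle :=
  fun w => ((∑ᶠ s : G, (h s : ℝ) * omegaOfZ f (s⁻¹ * w) : ℝ) : UnitAddCircle)

/-- Maximum principle: a function vanishing at infinity which is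
annihilated by a well-balanced `f` is nonpositive. -/
theorem WellBalancedZ.le_zero_of_harmonic {G : Type*} [Group G] [Infinite G] {f : G → ℤ}
    (hf : WellBalancedZ f) {y : G → ℝ} (hy : Tendsto y cofinite (𝓝 0))
    (hharm : ∀ t, ∑ s ∈ hf.1.toFinset, (f s : ℝ) * y (t * s) = 0) (a : G) : y a ≤ 0 := by
  by_contra! ha
  have hfin : {g | ¬ y g < y a}.Finite := hy.eventually_lt_const ha
  obtain ⟨m, hm, hmax⟩ := Set.exists_max_image _ y hfin ⟨a, by simp⟩
  have hm' : y a ≤ y m := by simpa using hm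
  have hle : ∀ g, y g ≤ y m := fun g => by
    by_cases hg : y g < y a
    · linarith
    · exact hmax g hg
  have hsum0 : ∑ s ∈ hf.1.toFinset, (f s : ℝ) = 0 := by
    have h0 := hf.2.1
    rw [finsum_eq_sum_of_support_subset f (s := hf.1.toFinset) (by simp)] at h0
    exact_mod_cast h0
  have hstep : ∀ t, y t = y m → ∀ s ∈ Function.support f, y (t * s) = y m := by
    intro t ht s hs
    have hz : ∑ s ∈ hf.1.toFinset, (f s : ℝ) * (y (t * s) - y m) = 0 := by
      simp only [mul_sub, Finset.sum_sub_distrib, hharm, ← Finset.sum_mul, hsum0]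
      simp
    rw [Finset.sum_eq_zero_iff_of_nonneg] at hz
    · have := hz s (by simpa using hs)
      rcases mul_eq_zero.1 this with h | h
      · exact absurd (by exact_mod_cast h) hs
      · linarith
    · intro r _
      by_cases hr : r = 1
      · simp [hr, ht]
      · exact mul_nonneg_of_nonpos_of_nonpos (by exact_mod_cast hf.2.2.1 r hr)
          (by linarith [hle (t * r)])
  have hall : ∀ g t, y t = y m → y (t * g) = y m := by
    intro g
    have hg : g ∈ Subgroup.closure (Function.support f) := by rw [hf.2.2.2.2]; trivial
    induction hg using Subgroup.closure_induction'' with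
    | mem s hs => exact fun t ht => hstep t ht s hs
    | inv_mem s hs =>
      exact fun t ht => hstep t ht s⁻¹ (by simpa [hf.2.2.2.1] using hs)
    | one => simp
    | mul u v _ _ hu hv =>
      intro t ht
      rw [← mul_assoc]
      exact hv _ (hu t ht)
  refine Set.infinite_univ (hfin.subset fun g _ => ?_)
  have := hall (m⁻¹ * g) m rfl
  simp only [mul_inv_cancel_left] at this
  simp [this, hm']

theorem WellBalancedZ.eq_zero_of_harmonic {G : Type*} [Group G] [Infinite G] {f : G → ℤ}
    (hf : WellBalancedZ f) {y : G → ℝ} (hy : Tendsto y cofinite (𝓝 0))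
    (hharm : ∀ t, ∑ s ∈ hf.1.toFinset, (f s : ℝ) * y (t * s) = 0) (a : G) : y a = 0 := by
  refine le_antisymm (hf.le_zero_of_harmonic hy hharm a) ?_
  have := hf.le_zero_of_harmonic (y := fun g => -y g) (by simpa using hy.neg)
    (fun t => by simp [hharm]) a
  simpa using this

theorem WellBalancedZ.apply_one_pos {G : Type*} [Group G] [Infinite G] {f : G → ℤ}
    (hf : WellBalancedZ f) : 0 < f 1 := by
  by_contra! h1
  have hnonpos : ∀ s, f s ≤ 0 := fun s => by
    by_cases hs : s = 1
    · rwa [hs]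
    · exact hf.2.2.1 s hs
  have h0 := hf.2.1
  rw [finsum_eq_sum_of_support_subset f (s := hf.1.toFinset) (by simp),
    Finset.sum_eq_zero_iff_of_nonpos fun s _ => hnonpos s] at h0
  have hsupp : Function.support f = ∅ := by
    ext s
    simp only [Function.mem_support, Set.mem_empty_iff_false, iff_false, not_not]
    by_contra hs
    exact hs (h0 s (by simpa using hs))
  have htop := hf.2.2.2.2
  rw [hsupp, Subgroup.closure_empty] at htop
  exact bot_ne_top htop

/-- Convolution by `u` as a sum over a finite set containing the support of `u`. -/
theorem convR_eq_sum {G : Type*} [Group G] {u : G → ℝ} {S : Finset G}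
    (hS : Function.support u ⊆ S) (v : G → ℝ) (w : G) :
    convR u v w = ∑ s ∈ S, u s * v (s⁻¹ * w) :=
  finsum_eq_sum_of_support_subset _ fun s hs => hS fun h => hs (by simp [h])

theorem convPow_support_finite {G : Type*} [Group G] {u : G → ℝ} {S : Finset G}
    (hS : Function.support u ⊆ S) (k : ℕ) : (Function.support (convPow u k)).Finite := by
  induction k with
  | zero =>
    refine (Set.finite_singleton (1 : G)).subset fun s hs => ?_
    by_contra h
    exact hs (if_neg h)
  | succ k ih =>
    have : (⋃ s ∈ S, (fun w => s⁻¹ * w) ⁻¹' Function.support (convPow u k)).Finite :=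
      S.finite_toSet.biUnion fun s _ => ih.preimage (mul_right_injective _).injOn
    refine this.subset fun w hw => ?_
    rw [Function.mem_support, convPow, convR_eq_sum hS] at hw
    obtain ⟨s, hs, h⟩ := Finset.exists_ne_zero_of_sum_ne_zero hw
    simp only [Set.mem_iUnion]
    exact ⟨s, hs, right_ne_zero_of_mul h⟩

/-- Convolution powers of a symmetric `u` satisfy the recursion with `u` on the right. -/
theorem sum_mul_convPow_mul_right {G : Type*} [Group G] {u : G → ℝ} {S : Finset G}
    (hS : Function.support u ⊆ S) (hu : ∀ s, u s⁻¹ = u s) (k : ℕ) (t : G) :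
    ∑ s ∈ S, u s * convPow u k (t * s) = convPow u (k + 1) t := by
  induction k generalizing t with
  | zero =>
    have key : ∀ r : G, ∑ s ∈ S, u s * (if s = r then 1 else 0) = u r := fun r => by
      simp only [mul_ite, mul_one, mul_zero, Finset.sum_ite_eq', ite_eq_left_iff]
      intro hr
      by_contra h
      exact hr (hS fun h' => h h'.symm)
    simp only [convPow, convR_eq_sum hS, mul_eq_one_iff_eq_inv', inv_inv,
      eq_comm (a := t)]
    rw [key, key, hu]
  | succ k ih =>
    have hright : convPow u (k + 1 + 1) t =
        ∑ r ∈ S, u r * ∑ s ∈ S, u s * convPow u k (r⁻¹ * t * s) := by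
      simp only [ih]
      rw [convPow, convR_eq_sum hS]
    rw [hright]
    simp only [convPow, convR_eq_sum hS, Finset.mul_sum]
    rw [Finset.sum_comm]
    refine Finset.sum_congr rfl fun r _ => Finset.sum_congr rfl fun s _ => ?_
    rw [mul_assoc]
    ring

theorem abs_convPow_le_iSup {G : Type*} [Group G] {u : G → ℝ} {S : Finset G}
    (hS : Function.support u ⊆ S) (k : ℕ) (s : G) :
    |convPow u k s| ≤ ⨆ r, |convPow u k r| := by
  refine le_ciSup (f := fun r => |convPow u k r|) (Set.Finite.bddAbove ?_) s
  refine (((convPow_support_finite hS k).image fun r => |convPow u k r|).insert 0).subset ?_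
  rintro _ ⟨r, rfl⟩
  by_cases hr : convPow u k r = 0
  · left; simp [hr]
  · right; exact ⟨r, hr, rfl⟩

theorem support_muOf_subset {G : Type*} [Group G] {f : G → ℤ} (hf : WellBalancedZ f) :
    Function.support (muOf fun s => (f s : ℝ)) ⊆ hf.1.toFinset := by
  intro s hs
  simp only [Set.Finite.coe_toFinset, Function.mem_support]
  intro h
  exact hs (by simp [muOf, h])

theorem tendsto_omegaOfZ {G : Type*} [Group G] {f : G → ℤ} (hf : WellBalancedZ f)
    (hsum : Summable fun k : ℕ => ⨆ s : G, |convPow (muOf fun s => (f s : ℝ)) k s|) :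
    Tendsto (omegaOfZ f) cofinite (𝓝 0) := by
  have hS := support_muOf_subset hf
  have h := tendsto_tsum_of_dominated_convergence (𝓕 := cofinite)
    (f := fun (s : G) (k : ℕ) => convPow (muOf fun s => (f s : ℝ)) k s) (g := fun _ => 0) hsum
    (fun k => tendsto_const_nhds.congr' (by
      filter_upwards [(convPow_support_finite hS k).compl_mem_cofinite] with s hs
      simpa [eq_comm] using hs))
    (Eventually.of_forall fun s k => abs_convPow_le_iSup hS k s)
  have hmul := h.const_mul (f 1 : ℝ)⁻¹
  rw [tsum_zero, mul_zero] at hmul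
  exact hmul

/-- `ω` is a fundamental solution: `ω f = δ_e`. -/
theorem sum_mul_omegaOfZ {G : Type*} [Group G] [Infinite G] {f : G → ℤ} (hf : WellBalancedZ f)
    (hsum : Summable fun k : ℕ => ⨆ s : G, |convPow (muOf fun s => (f s : ℝ)) k s|) (t : G) :
    ∑ s ∈ hf.1.toFinset, (f s : ℝ) * omegaOfZ f (t * s) = if t = 1 then 1 else 0 := by
  have hS := support_muOf_subset hf
  set u := muOf fun s => (f s : ℝ) with hu
  have h1 : (f 1 : ℝ) ≠ 0 := by exact_mod_cast hf.apply_one_pos.ne'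
  have hsymm : ∀ s, u s⁻¹ = u s := fun s => by simp [hu, muOf, hf.2.2.2.1]
  have hsm : ∀ s, Summable fun k => convPow u k s := fun s =>
    hsum.of_norm_bounded fun k => abs_convPow_le_iSup hS k s
  have hfu : ∀ s, (f s : ℝ) = f 1 * ((if s = 1 then 1 else 0) - u s) := fun s => by
    by_cases hs : s = 1
    · simp [hu, muOf, hs]
    · simp only [hs, if_false, hu, muOf]
      field_simp
      ring
  have hmem : (1 : G) ∈ hf.1.toFinset := by simpa using hf.apply_one_pos.ne'
  have hsumu : ∑ s ∈ hf.1.toFinset, u s * ∑' k, convPow u k (t * s) =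
      ∑' k, convPow u (k + 1) t := by
    simp only [← tsum_mul_left]
    rw [← Summable.tsum_finsetSum fun s _ => (hsm (t * s)).mul_left (u s)]
    exact tsum_congr fun k => sum_mul_convPow_mul_right hS hsymm k t
  calc ∑ s ∈ hf.1.toFinset, (f s : ℝ) * omegaOfZ f (t * s)
      = ∑ s ∈ hf.1.toFinset, ((if s = 1 then ∑' k, convPow u k (t * s) else 0)
          - u s * ∑' k, convPow u k (t * s)) := by
        refine Finset.sum_congr rfl fun s _ => ?_
        rw [hfu s, omegaOfZ, omegaOf, ← hu]
        split_ifs <;> field_simp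
        ring
    _ = ∑' k, convPow u k t - ∑' k, convPow u (k + 1) t := by
        rw [Finset.sum_sub_distrib, hsumu, Finset.sum_ite_eq', if_pos hmem, mul_one]
    _ = if t = 1 then 1 else 0 := by
        rw [(hsm t).tsum_eq_zero_add]
        simp [convPow]

/-- The real convolution `hω` is a sum over the support of `h`. -/
theorem homPt_eq_sum {G : Type*} [Group G] (f : G → ℤ) {h : G → ℤ}
    (hh : (Function.support h).Finite) (w : G) :
    homPt f h w = ((∑ s ∈ hh.toFinset, (h s : ℝ) * omegaOfZ f (s⁻¹ * w) : ℝ) : UnitAddCircle) := by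
  rw [homPt, finsum_eq_sum_of_support_subset]
  intro s hs
  simp only [Set.Finite.coe_toFinset, Function.mem_support]
  intro h0
  exact hs (by simp [h0])

theorem tendsto_sum_mul_omegaOfZ {G : Type*} [Group G] {f : G → ℤ} (hf : WellBalancedZ f)
    (hsum : Summable fun k : ℕ => ⨆ s : G, |convPow (muOf fun s => (f s : ℝ)) k s|)
    (h : G → ℤ) (T : Finset G) :
    Tendsto (fun w => ∑ r ∈ T, (h r : ℝ) * omegaOfZ f (r⁻¹ * w)) cofinite (𝓝 0) := by
  have := tendsto_finsetSum T fun r _ =>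
    ((tendsto_omegaOfZ hf hsum).comp (mul_right_injective r⁻¹).tendsto_cofinite).const_mul
      (h r : ℝ)
  simpa using this

/-- `(hω) f = h`. -/
theorem sum_mul_sum_mul_omegaOfZ {G : Type*} [Group G] [Infinite G] {f : G → ℤ}
    (hf : WellBalancedZ f)
    (hsum : Summable fun k : ℕ => ⨆ s : G, |convPow (muOf fun s => (f s : ℝ)) k s|)
    {h : G → ℤ} (hh : (Function.support h).Finite) (t : G) :
    ∑ s ∈ hf.1.toFinset, (f s : ℝ) *
      ∑ r ∈ hh.toFinset, (h r : ℝ) * omegaOfZ f (r⁻¹ * (t * s)) = h t := by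
  simp only [Finset.mul_sum]
  rw [Finset.sum_comm]
  have : ∀ r ∈ hh.toFinset, ∑ s ∈ hf.1.toFinset,
      (f s : ℝ) * ((h r : ℝ) * omegaOfZ f (r⁻¹ * (t * s))) = if r = t then (h r : ℝ) else 0 := by
    intro r _
    have := sum_mul_omegaOfZ hf hsum (r⁻¹ * t)
    simp only [inv_mul_eq_one] at this
    simp only [mul_left_comm (f _ : ℝ), ← Finset.mul_sum, ← mul_assoc r⁻¹, this]
    simp
  rw [Finset.sum_congr rfl this, Finset.sum_ite_eq']
  simp only [Set.Finite.mem_toFinset, Function.mem_support, ite_eq_left_iff, not_not]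
  intro h0
  simp [h0]

theorem mem_XfSet_iff {G : Type*} [Group G] {f : G → ℤ} (hf : WellBalancedZ f) {y : G → ℝ}
    {x : G → UnitAddCircle} (hx : ∀ g, x g = (y g : UnitAddCircle)) :
    x ∈ XfSet f ↔ ∀ t, ∃ n : ℤ, (n : ℝ) = ∑ s ∈ hf.1.toFinset, (f s : ℝ) * y (t * s) := by
  refine forall_congr' fun t => ?_
  rw [finsum_eq_sum_of_support_subset (s := hf.1.toFinset)]
  · have : ∑ s ∈ hf.1.toFinset, f s • x (t * s) =
        ((∑ s ∈ hf.1.toFinset, (f s : ℝ) * y (t * s) : ℝ) : UnitAddCircle) := by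
      rw [← QuotientAddGroup.mk'_apply, map_sum]
      refine Finset.sum_congr rfl fun s _ => ?_
      rw [hx, ← zsmul_eq_mul, map_zsmul, QuotientAddGroup.mk'_apply]
    rw [this, AddCircle.coe_eq_zero_iff]
    simp
  · intro s hs
    simp only [Set.Finite.coe_toFinset, Function.mem_support]
    intro h0
    exact hs (by simp [h0])

/-- A point of `(ℝ/ℤ)^Γ` converging to `0` lifts to a real function converging to `0`. -/
theorem exists_lift_tendsto_zero {G : Type*} {x : G → UnitAddCircle} {l : Filter G}
    (hx : Tendsto x l (𝓝 0)) :
    ∃ y : G → ℝ, (∀ g, x g = (y g : UnitAddCircle)) ∧ Tendsto y l (𝓝 0) := by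
  have hlift : ∀ z : UnitAddCircle, ∃ r : ℝ, z = (r : UnitAddCircle) ∧ |r| = ‖z‖ := by
    intro z
    obtain ⟨r, rfl⟩ := QuotientAddGroup.mk_surjective z
    refine ⟨r - round r, ?_, (UnitAddCircle.norm_eq (x := r)).symm⟩
    have : ((round r : ℝ) : UnitAddCircle) = 0 :=
      (AddCircle.coe_eq_zero_iff 1).2 ⟨round r, by simp⟩
    rw [AddCircle.coe_sub, this, sub_zero]
  choose lift hlift hnorm using hlift
  refine ⟨fun g => lift (x g), fun g => hlift _, ?_⟩
  rw [tendsto_zero_iff_norm_tendsto_zero]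
  simpa [hnorm] using hx.norm

/-- The homoclinic group of `X_f` equals `Q(ℤΓ·ω)`. -/
theorem stmt7 {G : Type*} [Group G] [Countable G] [Infinite G]
    (f : G → ℤ) (hf : WellBalancedZ f)
    (hsum : Summable (fun k : ℕ => ⨆ s : G, |convPow (muOf (fun s => (f s : ℝ))) k s|)) :
    (∀ x ∈ XfSet f,
      (Tendsto x cofinite (𝓝 0) ↔
        ∃ h : G → ℤ, (Function.support h).Finite ∧ x = homPt f h)) ∧
    (∀ h : G → ℤ, (Function.support h).Finite →
      homPt f h ∈ XfSet f ∧ Tendsto (homPt f h) cofinite (𝓝 0)) := by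
  have hpt : ∀ h : G → ℤ, (Function.support h).Finite →
      homPt f h ∈ XfSet f ∧ Tendsto (homPt f h) cofinite (𝓝 0) := by
    intro h hh
    refine ⟨(mem_XfSet_iff hf (homPt_eq_sum f hh)).2 fun t =>
      ⟨h t, (sum_mul_sum_mul_omegaOfZ hf hsum hh t).symm⟩, ?_⟩
    rw [funext (homPt_eq_sum f hh)]
    have hcont : Continuous ((↑) : ℝ → UnitAddCircle) := AddCircle.continuous_mk' 1
    exact (hcont.tendsto' 0 0 rfl).comp (tendsto_sum_mul_omegaOfZ hf hsum h hh.toFinset)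
  refine ⟨fun x hx => ⟨fun hx0 => ?_, ?_⟩, hpt⟩
  · obtain ⟨y, hxy, hy⟩ := exists_lift_tendsto_zero hx0
    choose h hh using (mem_XfSet_iff hf hxy).1 hx
    have hlim : Tendsto (fun t => (h t : ℝ)) cofinite (𝓝 0) := by
      simp only [hh]
      simpa using tendsto_finsetSum hf.1.toFinset fun s _ =>
        (hy.comp (mul_left_injective s).tendsto_cofinite).const_mul (f s : ℝ)
    have hfin : (Function.support h).Finite := by
      have hev : ∀ᶠ t in cofinite, h t = 0 := by
        filter_upwards [hlim.abs.eventually_lt_const (by simp : |(0 : ℝ)| < 1)] with t ht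
        exact Int.abs_lt_one_iff.1 (by exact_mod_cast ht)
      exact hev
    refine ⟨h, hfin, funext fun w => ?_⟩
    have hzero := hf.eq_zero_of_harmonic
      (by simpa using hy.sub (tendsto_sum_mul_omegaOfZ hf hsum h hfin.toFinset))
      (fun t => by
        simp only [mul_sub, Finset.sum_sub_distrib]
        rw [sum_mul_sum_mul_omegaOfZ hf hsum hfin, ← hh, sub_self]) w
    rw [hxy, homPt_eq_sum f hfin, sub_eq_zero.1 hzero]
  · rintro ⟨h, hh, rfl⟩
    exact (hpt h hh).2
end
end

section
/- Let Γ be a countably infinite group, f ∈ ℤΓ well-balanced, and (Γ_n)_{n≥1} a sequence of finite-index normal subgroups of Γ with ⋂_{n≥1} ⋃_{i≥n} Γ_i = {e}. Then Fix_{Γ_n}(X_f) converges to X_f in the Hausdorff distance as n → ∞: for every metric d on X_f inducing its (compact metrizable) topology, the Hausdorff distance between Fix_{Γ_n}(X_f) and X_f with respect to d tends to 0. -/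
open Filter Topology

/-- `Fix_N(X_f) = {x ∈ X_f : x_{γt} = x_t for all γ ∈ N, t ∈ Γ}`. -/
def fixSet {G : Type*} [Group G] (f : G → ℤ) (N : Subgroup G) :
    Set (G → UnitAddCircle) :=
  {x | x ∈ XfSet f ∧ ∀ γ ∈ N, ∀ t : G, x (γ * t) = x t}

open scoped Pointwise

section BallDichotomy

variable {Q : Type*} [Group Q] {T : Set Q}

theorem inv_mem_pow_of_symmetric (hinv : ∀ s ∈ T, s⁻¹ ∈ T) {j : ℕ} {q : Q}
    (hq : q ∈ T ^ j) : q⁻¹ ∈ T ^ j := by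
  have hT : T⁻¹ = T := by
    ext s
    exact ⟨fun h => by simpa using hinv _ h, fun h => hinv s h⟩
  rw [← Set.mem_inv, ← inv_pow, hT]
  exact hq

/-- A set of at most half the size of a finite group whose edge boundary in the Cayley graph lies
in a ball is contained in the ball of twice the radius. -/
theorem subset_pow_of_locally_constant [Finite Q] (h1 : 1 ∈ T) (hinv : ∀ s ∈ T, s⁻¹ ∈ T)
    (hgen : ∀ q, ∃ j, q ∈ T ^ j) {R : ℕ} {A : Set Q}
    (hA : ∀ v ∉ T ^ R, ∀ s ∈ T, (v * s ∈ A ↔ v ∈ A)) (hcard : A.ncard ≤ Aᶜ.ncard) :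
    A ⊆ T ^ (R + R) := by
  intro x hxA
  by_contra hx
  have hmono : ∀ {i j : ℕ}, i ≤ j → T ^ i ⊆ T ^ j := fun h => Set.pow_subset_pow_right h1 h
  have hdisj : ∀ b ∈ T ^ R, x * b ∉ T ^ R := by
    intro b hb hxb
    apply hx
    rw [pow_add]
    exact Set.mem_mul.2 ⟨x * b, hxb, b⁻¹, inv_mem_pow_of_symmetric hinv hb, by group⟩
  have hdisj' : ∀ b ∈ T ^ R, x⁻¹ * b ∉ T ^ R := by
    intro b hb hxb
    exact hdisj _ hxb (by simpa using hb)
  have hball : ∀ j ≤ R, ∀ b ∈ T ^ j, x * b ∈ A := by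
    intro j
    induction j with
    | zero => intro _ b hb; simp at hb; simpa [hb] using hxA
    | succ j ih =>
      intro hj b hb
      rw [pow_succ] at hb
      obtain ⟨b', hb', s, hs, rfl⟩ := Set.mem_mul.1 hb
      rw [← mul_assoc]
      exact (hA _ (hdisj b' (hmono (by omega) hb')) s hs).2 (ih (by omega) b' hb')
  have hcenter : ∀ j ≤ R, ∀ b ∈ T ^ j, (x⁻¹ * b ∈ A ↔ x⁻¹ ∈ A) := by
    intro j
    induction j with
    | zero => intro _ b hb; simp at hb; simp [hb]
    | succ j ih =>
      intro hj b hb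
      rw [pow_succ] at hb
      obtain ⟨b', hb', s, hs, rfl⟩ := Set.mem_mul.1 hb
      rw [← mul_assoc, hA _ (hdisj' b' (hmono (by omega) hb')) s hs]
      exact ih (by omega) b' hb'
  have hcompl : ∀ j, ∀ v ∈ T ^ j, v ∉ A → (x⁻¹ * v ∈ A ↔ x⁻¹ ∈ A) := by
    intro j
    induction j with
    | zero => intro v hv _; simp at hv; simp [hv]
    | succ j ih =>
      intro v hv hvA
      by_cases hvR : v ∈ T ^ R
      · exact hcenter R le_rfl v hvR
      rw [pow_succ] at hv
      obtain ⟨w, hw, s, hs, rfl⟩ := Set.mem_mul.1 hv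
      have hwA : w ∉ A := by
        have := hA _ hvR _ (hinv s hs)
        simp only [mul_inv_cancel_right] at this
        rwa [this]
      have hout : x⁻¹ * (w * s) ∉ T ^ R := fun h => hvA (by simpa using hball R le_rfl _ h)
      have := hA _ hout _ (hinv s hs)
      rw [← ih w hw hwA, ← this]
      simp [mul_assoc]
  have hconst : ∀ v, v ∉ A ∨ v ∈ T ^ R → (x⁻¹ * v ∈ A ↔ x⁻¹ ∈ A) := by
    rintro v (hv | hv)
    · obtain ⟨j, hj⟩ := hgen v
      exact hcompl j v hj hv
    · exact hcenter R le_rfl v hv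
  have hempty : A \ T ^ R = A := by
    apply Set.eq_of_subset_of_ncard_le Set.sdiff_subset
    by_cases hxi : x⁻¹ ∈ A
    · refine hcard.trans ?_
      rw [← Set.ncard_image_of_injective Aᶜ (mul_right_injective x)]
      refine Set.ncard_le_ncard ?_
      rintro _ ⟨v, hv, rfl⟩
      by_contra hc
      refine hv ?_
      have := hconst (x * v) (by by_contra! h; exact hc ⟨h.1, h.2⟩)
      simpa [hxi] using this
    · rw [← Set.ncard_image_of_injective A (mul_right_injective x)]
      refine Set.ncard_le_ncard ?_
      rintro _ ⟨v, hv, rfl⟩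
      by_contra hc
      have := hconst (x * v) (by by_contra! h; exact hc ⟨h.1, h.2⟩)
      simp [hxi] at this
      exact this hv
  have hflat : ∀ v ∈ A, ∀ s ∈ T, v * s ∈ A := by
    intro v hv s hs
    rw [← hempty] at hv
    exact (hA v hv.2 s hs).2 hv.1
  have hall : ∀ j, ∀ b ∈ T ^ j, ∀ v ∈ A, v * b ∈ A := by
    intro j
    induction j with
    | zero => intro b hb v hv; simp at hb; simpa [hb] using hv
    | succ j ih =>
      intro b hb v hv
      rw [pow_succ] at hb
      obtain ⟨b', hb', s, hs, rfl⟩ := Set.mem_mul.1 hb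
      rw [← mul_assoc]
      exact hflat _ (ih b' hb' v hv) s hs
  obtain ⟨j, hj⟩ := hgen x⁻¹
  have h1A : (1 : Q) ∈ A := by simpa using hall j _ hj x hxA
  rw [← hempty] at h1A
  exact h1A.2 (hmono (Nat.zero_le R) (by simp))

/-- A function on a finite group that is locally constant off a ball of the Cayley graph is
constant off the ball of twice the radius. -/
theorem exists_const_off_ball [Finite Q] {α : Type*} (h1 : 1 ∈ T)
    (hinv : ∀ s ∈ T, s⁻¹ ∈ T) (hgen : ∀ q, ∃ j, q ∈ T ^ j) {R : ℕ} {u : Q → α}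
    (hu : ∀ v ∉ T ^ R, ∀ s ∈ T, u (v * s) = u v) :
    ∃ c, ∀ v ∉ T ^ (R + R), u v = c := by
  have key : ∀ c, {v | u v = c} ⊆ T ^ (R + R) ∨ {v | u v = c}ᶜ ⊆ T ^ (R + R) := by
    intro c
    rcases le_total {v | u v = c}.ncard {v | u v = c}ᶜ.ncard with h | h
    · refine Or.inl (subset_pow_of_locally_constant h1 hinv hgen (fun v hv s hs => ?_) h)
      simp [hu v hv s hs]
    · refine Or.inr (subset_pow_of_locally_constant h1 hinv hgen (fun v hv s hs => ?_) ?_)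
      · simp [hu v hv s hs]
      · simpa using h
  by_cases h : ∃ c, {v | u v = c}ᶜ ⊆ T ^ (R + R)
  · obtain ⟨c, hc⟩ := h
    exact ⟨c, fun v hv => by by_contra hne; exact hv (hc hne)⟩
  · push Not at h
    refine ⟨u 1, fun v hv => ?_⟩
    exact absurd (((key (u v)).resolve_right (h _)) rfl) hv

end BallDichotomy

section FiniteQuotient

/-- `f` is the coefficient function of a symmetric weighted Laplacian and `S` consists of the
identity and the support of `f`. -/
structure IsLaplacianOn {G : Type*} [Group G] (f : G → ℤ) (S : Finset G) : Prop where
  one_mem : 1 ∈ S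
  neg_of_mem : ∀ s ∈ S, s ≠ 1 → f s < 0
  eq_zero_of_notMem : ∀ s ∉ S, f s = 0
  sum_eq_zero : ∑ s ∈ S, f s = 0
  symm : ∀ s, f s⁻¹ = f s

namespace IsLaplacianOn

variable {G Q : Type*} [Group G] [Group Q] {f : G → ℤ} {S : Finset G}

theorem inv_mem (hS : IsLaplacianOn f S) {s : G} (hs : s ∈ S) : s⁻¹ ∈ S := by
  by_contra h
  have h0 := hS.eq_zero_of_notMem _ h
  rw [hS.symm] at h0
  by_cases h1 : s = 1
  · exact h (by simpa [h1] using hS.one_mem)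
  · exact (hS.neg_of_mem s hs h1).ne h0

theorem sum_inv {M : Type*} [AddCommMonoid M] (hS : IsLaplacianOn f S) (φ : G → M) :
    ∑ s ∈ S, φ s⁻¹ = ∑ s ∈ S, φ s :=
  Finset.sum_nbij' (fun s => s⁻¹) (fun s => s⁻¹) (fun _ h => hS.inv_mem h)
    (fun _ h => hS.inv_mem h) (by simp) (by simp) (by simp)

theorem sum_mul_sub (hS : IsLaplacianOn f S) (π : G →* Q) (u : Q → ℤ) (q : Q) :
    ∑ s ∈ S, f s * (u (q * π s) - u q) = ∑ s ∈ S, f s * u (q * π s) := by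
  simp only [mul_sub, Finset.sum_sub_distrib, ← Finset.sum_mul, hS.sum_eq_zero]
  simp

theorem sum_mul_sq_sub [Fintype Q] (hS : IsLaplacianOn f S) (π : G →* Q) (u : Q → ℤ) :
    ∑ q, ∑ s ∈ S, f s * (u (q * π s) - u q) ^ 2 =
      -2 * ∑ q, (∑ s ∈ S, f s * u (q * π s)) * u q := by
  have hsq : ∑ q, ∑ s ∈ S, f s * u (q * π s) ^ 2 = 0 := by
    rw [Finset.sum_comm]
    have : ∀ s, ∑ q, f s * u (q * π s) ^ 2 = f s * ∑ q, u q ^ 2 := fun s => by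
      rw [← Finset.mul_sum]
      exact congrArg _ (Equiv.sum_comp (Equiv.mulRight (π s)) (fun q => u q ^ 2))
    simp only [this, ← Finset.sum_mul, hS.sum_eq_zero, zero_mul]
  have hexp : ∀ q, ∑ s ∈ S, f s * (u (q * π s) - u q) ^ 2 =
      ∑ s ∈ S, f s * u (q * π s) ^ 2 - 2 * ((∑ s ∈ S, f s * u (q * π s)) * u q) := by
    intro q
    have h0 : ∑ s ∈ S, f s * u q ^ 2 = 0 := by rw [← Finset.sum_mul, hS.sum_eq_zero, zero_mul]
    rw [← add_zero (∑ s ∈ S, f s * u (q * π s) ^ 2 - _), ← h0, Finset.sum_mul, Finset.mul_sum,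
      ← Finset.sum_sub_distrib, ← Finset.sum_add_distrib]
    exact Finset.sum_congr rfl fun s _ => by ring
  rw [Finset.sum_congr rfl fun q _ => hexp q, Finset.sum_sub_distrib, hsq, ← Finset.mul_sum]
  ring

theorem abs_sub_le_of_mem_pow {π : G →* Q} {u : Q → ℤ} {m : ℤ}
    (hm : ∀ q, ∀ s ∈ S, |u (q * π s) - u q| ≤ m) {j : ℕ} {b : G} (hb : b ∈ (S : Set G) ^ j)
    (q : Q) : |u (q * π b) - u q| ≤ j * m := by
  induction j generalizing b with
  | zero => simp at hb; simp [hb]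
  | succ j ih =>
    rw [pow_succ] at hb
    obtain ⟨b', hb', s, hs, rfl⟩ := Set.mem_mul.1 hb
    have h1 := ih hb'
    have h2 := hm (q * π b') s hs
    rw [map_mul, ← mul_assoc]
    have := abs_sub_le (u (q * π b' * π s)) (u (q * π b')) (u q)
    push_cast
    linarith

open Classical in
/-- An integral solution of a Poisson equation on a finite quotient has bounded gradient,
uniformly in the quotient. -/
theorem abs_gradient_le [Fintype Q] (hS : IsLaplacianOn f S) {π : G →* Q} {F : Finset G}
    {k : G → ℤ} {r : ℕ} (hF : ∀ t ∈ F, t ∈ (S : Set G) ^ r) {u : Q → ℤ}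
    (hu : ∀ q, ∑ s ∈ S, f s * u (q * π s) = ∑ t ∈ F, if π t = q then k t else 0) (q : Q) {s : G}
    (hs : s ∈ S) : |u (q * π s) - u q| ≤ 2 * (∑ t ∈ F, |k t|) * r := by
  obtain ⟨⟨q₀, s₀⟩, hmem, hmax⟩ := Finset.exists_max_image (Finset.univ ×ˢ S)
    (fun p : Q × G => |u (p.1 * π p.2) - u p.1|) ⟨(q, s), by simpa using hs⟩
  set m := |u (q₀ * π s₀) - u q₀| with hmdef
  have hs₀ : s₀ ∈ S := by simpa using hmem
  have hm : ∀ q, ∀ s ∈ S, |u (q * π s) - u q| ≤ m := fun q s hs => hmax (q, s) (by simpa using hs)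
  have hm0 : 0 ≤ m := abs_nonneg _
  refine (hm q s hs).trans ?_
  have hnn : ∀ q, ∀ s ∈ S, 0 ≤ -f s * (u (q * π s) - u q) ^ 2 := by
    intro q s hs
    by_cases h1 : s = 1
    · simp [h1]
    · have := hS.neg_of_mem s hs h1
      exact mul_nonneg (by omega) (sq_nonneg _)
  have hterm : m ^ 2 ≤ -f s₀ * (u (q₀ * π s₀) - u q₀) ^ 2 := by
    by_cases h1 : s₀ = 1
    · simp [hmdef, h1]
    · have := hS.neg_of_mem s₀ hs₀ h1
      rw [hmdef, sq_abs]
      nlinarith [sq_nonneg (u (q₀ * π s₀) - u q₀)]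
  have hle : m ^ 2 ≤ ∑ q, ∑ s ∈ S, -f s * (u (q * π s) - u q) ^ 2 :=
    hterm.trans <| (Finset.single_le_sum (f := fun s => -f s * (u (q₀ * π s) - u q₀) ^ 2)
      (hnn q₀) hs₀).trans <|
      Finset.single_le_sum (f := fun q => ∑ s ∈ S, -f s * (u (q * π s) - u q) ^ 2)
        (fun q _ => Finset.sum_nonneg (hnn q)) (Finset.mem_univ q₀)
  have hpair : ∀ w : Q → ℤ, ∑ q, (∑ s ∈ S, f s * u (q * π s)) * w q = ∑ t ∈ F, k t * w (π t) := by
    intro w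
    simp only [hu, Finset.sum_mul]
    rw [Finset.sum_comm]
    exact Finset.sum_congr rfl fun t _ => by simp [ite_mul]
  have hk : ∑ t ∈ F, k t = 0 := by
    have h := hpair (fun _ => 1)
    simp only [mul_one] at h
    rw [← h, Finset.sum_comm]
    have : ∀ s, ∑ q, f s * u (q * π s) = f s * ∑ q, u q := fun s => by
      rw [← Finset.mul_sum]
      exact congrArg _ (Equiv.sum_comp (Equiv.mulRight (π s)) u)
    simp only [this, ← Finset.sum_mul, hS.sum_eq_zero, zero_mul]
  have henergy : m ^ 2 ≤ 2 * ∑ t ∈ F, k t * (u (π t) - u 1) := by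
    have h := hS.sum_mul_sq_sub π u
    rw [hpair u] at h
    simp only [neg_mul, Finset.sum_neg_distrib] at hle
    simp only [mul_sub, Finset.sum_sub_distrib, ← Finset.sum_mul, hk]
    linarith
  have hbound : ∑ t ∈ F, k t * (u (π t) - u 1) ≤ (∑ t ∈ F, |k t|) * (r * m) := by
    rw [Finset.sum_mul]
    refine Finset.sum_le_sum fun t ht => (le_abs_self _).trans ?_
    rw [abs_mul]
    have := abs_sub_le_of_mem_pow hm (hF t ht) 1
    rw [one_mul] at this
    exact mul_le_mul_of_nonneg_left this (abs_nonneg _)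
  rcases hm0.eq_or_lt with h0 | h0
  · rw [← h0]
    have : 0 ≤ ∑ t ∈ F, |k t| := Finset.sum_nonneg fun _ _ => abs_nonneg _
    positivity
  · nlinarith

theorem exists_lt_of_ne (hS : IsLaplacianOn f S) {π : G →* Q} {u : Q → ℤ} {v : Q}
    (h0 : ∑ s ∈ S, f s * u (v * π s) = 0) {s : G} (hs : s ∈ S) (hne : u (v * π s) ≠ u v) :
    ∃ s ∈ S, u v < u (v * π s) := by
  by_contra! hle
  rw [← hS.sum_mul_sub] at h0
  have hnn : ∀ s ∈ S, 0 ≤ f s * (u (v * π s) - u v) := by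
    intro s hs
    by_cases h1 : s = 1
    · simp [h1]
    · exact mul_nonneg_of_nonpos_of_nonpos (hS.neg_of_mem s hs h1).le (by linarith [hle s hs])
  have := (Finset.sum_eq_zero_iff_of_nonneg hnn).1 h0 s hs
  have hs1 : s ≠ 1 := by rintro rfl; simp at hne
  rcases mul_eq_zero.1 this with h | h
  · exact (hS.neg_of_mem s hs hs1).ne h
  · exact hne (by linarith)

/-- Climbing along a function with Laplacian vanishing off `P`, one reaches `P`. -/
theorem exists_mem_climb [Finite Q] (hS : IsLaplacianOn f S) {π : G →* Q} {u : Q → ℤ} {P : Set Q}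
    (h0 : ∀ q ∉ P, ∑ s ∈ S, f s * u (q * π s) = 0) {v : Q} {s : G} (hs : s ∈ S)
    (hne : u (v * π s) ≠ u v) :
    ∃ j : ℕ, ∃ b ∈ (S : Set G) ^ j, v * π b ∈ P ∧ u v + j ≤ u (v * π b) := by
  obtain ⟨M, hM⟩ := (Set.finite_range u).bddAbove
  have hM' : ∀ q, u q ≤ M := fun q => hM ⟨q, rfl⟩
  induction hd : (M - u v).toNat using Nat.strong_induction_on generalizing v s with
  | _ d ih =>
    by_cases hv : v ∈ P
    · exact ⟨0, 1, by simp, by simpa using hv, by simp⟩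
    obtain ⟨s', hs', hlt⟩ := hS.exists_lt_of_ne (h0 v hv) hs hne
    have h1 := hM' (v * π s')
    obtain ⟨j, b, hb, hbP, hle⟩ := ih (M - u (v * π s')).toNat (by omega)
      (v := v * π s') (hS.inv_mem hs') (by simpa using hlt.ne) rfl
    refine ⟨j + 1, s' * b, ?_, by simpa [mul_assoc] using hbP, ?_⟩
    · rw [pow_succ']
      exact Set.mul_mem_mul hs' hb
    · rw [map_mul, ← mul_assoc]
      push_cast
      omega

open Classical in
/-- An integral solution of a Poisson equation on a finite quotient is constant off a ball whose
radius does not depend on the quotient. -/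
theorem exists_const_off_ball [Finite Q] (hS : IsLaplacianOn f S)
    (hgen : ∀ g : G, ∃ j, g ∈ (S : Set G) ^ j) {π : G →* Q} (hπ : Function.Surjective π)
    {F : Finset G} {k : G → ℤ} {r : ℕ} (hF : ∀ t ∈ F, t ∈ (S : Set G) ^ r) {u : Q → ℤ}
    (hu : ∀ q, ∑ s ∈ S, f s * u (q * π s) = ∑ t ∈ F, if π t = q then k t else 0) {R : ℕ}
    (hR : r + 2 * r * (2 * (∑ t ∈ F, |k t|) * r) ≤ R) :
    ∃ c, ∀ v ∉ π '' (S : Set G) ^ (R + R), u v = c := by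
  cases nonempty_fintype Q
  have h1 : (1 : G) ∈ (S : Set G) := hS.one_mem
  have hinvS : ∀ s ∈ (S : Set G), s⁻¹ ∈ (S : Set G) := fun s hs => hS.inv_mem hs
  simp only [Set.image_pow]
  refine _root_.exists_const_off_ball (T := π '' (S : Set G)) ⟨1, h1, map_one π⟩ ?_ ?_ ?_
  · rintro _ ⟨s, hs, rfl⟩
    exact ⟨s⁻¹, hS.inv_mem hs, map_inv π s⟩
  · intro q
    obtain ⟨g, rfl⟩ := hπ q
    obtain ⟨j, hj⟩ := hgen g
    exact ⟨j, by rw [← Set.image_pow]; exact ⟨g, hj, rfl⟩⟩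
  · rintro v hv _ ⟨s, hs, rfl⟩
    by_contra hne
    apply hv
    set m := 2 * (∑ t ∈ F, |k t|) * r with hm
    have hgrad : ∀ q, ∀ s ∈ S, |u (q * π s) - u q| ≤ m := fun q s hs =>
      hS.abs_gradient_le hF hu q hs
    have h0 : ∀ q ∉ π '' (F : Set G), ∑ s ∈ S, f s * u (q * π s) = 0 := by
      intro q hq
      rw [hu]
      exact Finset.sum_eq_zero fun t ht => if_neg fun h => hq ⟨t, ht, h⟩
    obtain ⟨j, b, hb, ⟨t, ht, htb⟩, hle⟩ := hS.exists_mem_climb h0 hs hne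
    obtain ⟨i, b', hb', ⟨t', ht', htb'⟩, hle'⟩ := hS.exists_mem_climb (u := fun q => -u q)
      (fun q hq => by simpa using h0 q hq) (v := v) hs (by simpa using hne)
    have e1 := abs_le.1 (abs_sub_le_of_mem_pow hgrad (hF t ht) 1)
    have e2 := abs_le.1 (abs_sub_le_of_mem_pow hgrad (hF t' ht') 1)
    rw [one_mul] at e1 e2
    rw [← htb] at hle
    rw [← htb'] at hle'
    have hj : r + j ≤ R := by
      zify
      nlinarith
    rw [← Set.image_pow]
    refine ⟨t * b⁻¹, Set.pow_subset_pow_right h1 hj ?_, by rw [map_mul, htb, map_inv]; group⟩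
    rw [pow_add]
    exact Set.mul_mem_mul (hF t ht) (inv_mem_pow_of_symmetric hinvS hb)

theorem exists_addMonoidHom_unitAddCircle_ne_zero {A : Type*} [AddCommGroup A] {a : A}
    (ha : a ≠ 0) : ∃ c : A →+ UnitAddCircle, c a ≠ 0 := by
  obtain ⟨c, hc⟩ := CharacterModule.exists_character_apply_ne_zero_of_ne_zero ha
  let c' : A →+ AddCircle (1 : ℚ) := c
  let e : AddCircle (1 : ℚ) →+ UnitAddCircle :=
    QuotientAddGroup.map _ _ (Rat.castHom ℝ).toAddMonoidHom (by
      intro x hx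
      obtain ⟨n, rfl⟩ := AddSubgroup.mem_zmultiples_iff.1 hx
      exact AddSubgroup.mem_zmultiples_iff.2 ⟨n, by simp⟩)
  have he : Function.Injective e := by
    rw [injective_iff_map_eq_zero]
    intro x
    induction x using QuotientAddGroup.induction_on with
    | H x =>
      intro hx
      obtain ⟨n, hn⟩ := AddSubgroup.mem_zmultiples_iff.1 ((QuotientAddGroup.eq_zero_iff _).1 hx)
      refine (QuotientAddGroup.eq_zero_iff _).2 (AddSubgroup.mem_zmultiples_iff.2 ⟨n, ?_⟩)
      have hn' : (n : ℝ) = (x : ℝ) := by simpa using hn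
      simpa using (by exact_mod_cast hn' : (n : ℚ) = x)
  refine ⟨e.comp c', fun h => hc ?_⟩
  exact he ((show e (c' a) = 0 from h).trans (map_zero e).symm)

/-- An integral function on a finite quotient that annihilates every circle-valued harmonic
function is a Laplacian. -/
theorem exists_laplacian_eq [Fintype Q] (hS : IsLaplacianOn f S) {π : G →* Q} {h : Q → ℤ}
    (hh : ∀ z : Q → UnitAddCircle, (∀ q, ∑ s ∈ S, f s • z (q * π s) = 0) → ∑ q, h q • z q = 0) :
    ∃ u : Q → ℤ, ∀ q, ∑ s ∈ S, f s * u (q * π s) = h q := by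
  classical
  let L : (Q → ℤ) →+ (Q → ℤ) :=
    { toFun := fun u q => ∑ s ∈ S, f s * u (q * π s)
      map_zero' := by ext; simp
      map_add' := fun u w => by ext; simp [mul_add, Finset.sum_add_distrib] }
  by_contra hcon
  have hne : (QuotientAddGroup.mk h : (Q → ℤ) ⧸ L.range) ≠ 0 := by
    intro h0
    obtain ⟨u, hu⟩ := (QuotientAddGroup.eq_zero_iff _).1 h0
    exact hcon ⟨u, fun q => congrFun hu q⟩
  obtain ⟨c, hc⟩ := exists_addMonoidHom_unitAddCircle_ne_zero hne
  let c' : (Q → ℤ) →+ UnitAddCircle := c.comp (QuotientAddGroup.mk' L.range)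
  have hexp : ∀ w : Q → ℤ, c' w = ∑ q, w q • c' (Pi.single q 1) := by
    intro w
    conv_lhs => rw [← Finset.univ_sum_single w]
    rw [map_sum]
    refine Finset.sum_congr rfl fun q _ => ?_
    rw [← map_zsmul, ← Pi.single_smul]
    simp
  apply hc
  change c' h = 0
  rw [hexp]
  refine hh _ fun q => ?_
  have hrange : c' (L (Pi.single q 1)) = 0 := by
    have : (QuotientAddGroup.mk (L (Pi.single q 1)) : (Q → ℤ) ⧸ L.range) = 0 :=
      (QuotientAddGroup.eq_zero_iff _).2 ⟨_, rfl⟩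
    change c (QuotientAddGroup.mk (L (Pi.single q 1))) = 0
    rw [this, map_zero]
  rw [← hrange, ← hS.sum_inv]
  simp only [← map_zsmul, ← map_sum]
  congr 1
  ext p
  simp only [hS.symm, Finset.sum_apply, Pi.smul_apply, L, AddMonoidHom.coe_mk, ZeroHom.coe_mk,
    smul_eq_mul, Pi.single_apply, map_inv, eq_mul_inv_iff_mul_eq]

/-- A finitely supported integral function that annihilates the harmonic functions of a finite
quotient annihilates all harmonic functions, provided the quotient map is injective on a
sufficiently large ball. -/
theorem sum_smul_eq_zero_of_quotient [Finite Q] (hS : IsLaplacianOn f S)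
    (hgen : ∀ g : G, ∃ j, g ∈ (S : Set G) ^ j) {π : G →* Q} (hπ : Function.Surjective π)
    {F : Finset G} {k : G → ℤ} {r : ℕ} (hF : ∀ t ∈ F, t ∈ (S : Set G) ^ r) {R : ℕ}
    (hR : r + 2 * r * (2 * (∑ t ∈ F, |k t|) * r) ≤ R)
    (hinj : Set.InjOn π ((S : Set G) ^ (R + R + 2)))
    (hk : ∀ z : Q → UnitAddCircle, (∀ q, ∑ s ∈ S, f s • z (q * π s) = 0) →
      ∑ t ∈ F, k t • z (π t) = 0)
    {x : G → UnitAddCircle} (hx : ∀ t, ∑ s ∈ S, f s • x (t * s) = 0) :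
    ∑ t ∈ F, k t • x t = 0 := by
  classical
  cases nonempty_fintype Q
  obtain ⟨u, hu⟩ := hS.exists_laplacian_eq (π := π)
    (h := fun q => ∑ t ∈ F, if π t = q then k t else 0) (by
      intro z hz
      rw [← hk z hz]
      simp only [Finset.sum_smul]
      rw [Finset.sum_comm]
      exact Finset.sum_congr rfl fun t _ => by simp [ite_smul])
  obtain ⟨c, hc⟩ := hS.exists_const_off_ball hgen hπ hF hu hR
  have h1 : (1 : G) ∈ (S : Set G) := hS.one_mem
  have hmono : ∀ {i j : ℕ}, i ≤ j → (S : Set G) ^ i ⊆ (S : Set G) ^ j := fun h =>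
    Set.pow_subset_pow_right h1 h
  have hrR : r ≤ R := by
    have : 0 ≤ ∑ t ∈ F, |k t| := Finset.sum_nonneg fun _ _ => abs_nonneg _
    have : 0 ≤ 2 * r * (2 * (∑ t ∈ F, |k t|) * r) := by positivity
    zify
    linarith
  let g : G → ℤ := fun t => if t ∈ S ^ (R + R) then u (π t) - c else 0
  have hmem : ∀ {j : ℕ} {t : G}, t ∈ S ^ j ↔ t ∈ (S : Set G) ^ j := fun {j t} => by
    rw [← Finset.mem_coe, Finset.coe_pow]
  have hg : ∀ t ∈ S ^ (R + R + 2), g t = u (π t) - c := by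
    intro t ht
    by_cases h : t ∈ S ^ (R + R)
    · simp [g, h]
    · rw [hmem] at ht
      simp only [g, h, if_false]
      rw [hc, sub_self]
      rintro ⟨b, hb, hbt⟩
      exact h (hmem.2 (hinj (hmono (by omega) hb) ht hbt ▸ hb))
  have hlap : ∀ t ∈ S ^ (R + R + 1), ∑ s ∈ S, f s * g (t * s) = if t ∈ F then k t else 0 := by
    intro t ht
    have hstep : ∀ s ∈ S, f s * g (t * s) = f s * (u (π t * π s)) - f s * c := by
      intro s hs
      rw [hg (t * s) (by rw [pow_succ (n := R + R + 1)]; exact Finset.mul_mem_mul ht hs), map_mul,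
        mul_sub]
    rw [Finset.sum_congr rfl hstep, Finset.sum_sub_distrib, ← Finset.sum_mul, hS.sum_eq_zero,
      zero_mul, sub_zero, hu, ← Finset.sum_ite_eq' F t k]
    refine Finset.sum_congr rfl fun t' ht' => ?_
    have : π t' = π t ↔ t' = t :=
      hinj.eq_iff (hmono (by omega) (hF t' ht')) (hmono (by omega) (hmem.1 ht))
    simp [this]
  have hFsub : F ⊆ S ^ (R + R + 1) := fun t ht => hmem.2 (hmono (by omega) (hF t ht))
  calc ∑ t ∈ F, k t • x t
      = ∑ t ∈ S ^ (R + R + 1), (if t ∈ F then k t else 0) • x t := by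
        rw [← Finset.sum_subset hFsub fun t _ ht => by simp [ht]]
        exact Finset.sum_congr rfl fun t ht => by simp [ht]
    _ = ∑ s ∈ S, ∑ t ∈ S ^ (R + R + 1), f s • g (t * s) • x t := by
        rw [Finset.sum_comm]
        refine Finset.sum_congr rfl fun t ht => ?_
        rw [← hlap t ht, Finset.sum_smul]
        exact Finset.sum_congr rfl fun s _ => mul_smul _ _ _
    _ = ∑ s ∈ S, ∑ w ∈ S ^ (R + R), f s • g w • x (w * s⁻¹) := by
        refine Finset.sum_congr rfl fun s hs => (Finset.sum_of_injOn (fun w => w * s⁻¹) ?_ ?_ ?_ ?_).symm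
        · exact (mul_left_injective s⁻¹).injOn
        · intro w hw
          rw [Finset.coe_pow, pow_succ]
          rw [Finset.coe_pow] at hw
          exact Set.mul_mem_mul hw (hS.inv_mem hs)
        · intro t _ ht
          have : t * s ∉ S ^ (R + R) := fun h => ht ⟨t * s, h, by simp⟩
          simp [g, this]
        · intro w _
          simp
    _ = ∑ w ∈ S ^ (R + R), g w • ∑ s ∈ S, f s • x (w * s⁻¹) := by
        rw [Finset.sum_comm]
        refine Finset.sum_congr rfl fun w _ => ?_
        rw [Finset.smul_sum]
        exact Finset.sum_congr rfl fun s _ => smul_comm _ _ _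
    _ = 0 := by
        refine Finset.sum_eq_zero fun w _ => ?_
        have := hS.sum_inv fun s => f s • x (w * s)
        simp only [hS.symm] at this
        rw [this, hx, smul_zero]

end IsLaplacianOn

end FiniteQuotient

section HausdorffConvergence

open MeasureTheory UnitAddTorus

variable {ι : Type*}

/-- The normalized Haar measure of a closed subgroup of a torus. -/
noncomputable def subgroupHaar [Countable ι] (L : AddSubgroup (ι → UnitAddCircle))
    [CompactSpace L] : Measure L :=
  Measure.addHaarMeasure ⊤

instance [Countable ι] (L : AddSubgroup (ι → UnitAddCircle)) [CompactSpace L] :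
    (subgroupHaar L).IsAddHaarMeasure :=
  inferInstanceAs (Measure.addHaarMeasure ⊤).IsAddHaarMeasure

instance [Countable ι] (L : AddSubgroup (ι → UnitAddCircle)) [CompactSpace L] :
    IsProbabilityMeasure (subgroupHaar L) :=
  ⟨Measure.addHaarMeasure_self (K₀ := (⊤ : TopologicalSpace.PositiveCompacts L))⟩

theorem mFourier_apply_eq_toCircle {d : Type*} [Fintype d] (k : d → ℤ) (y : UnitAddTorus d) :
    mFourier k y = ((∑ i, k i • y i : UnitAddCircle).toCircle : ℂ) := by
  classical
  have h : ∀ s : Finset d, ((∑ i ∈ s, k i • y i : UnitAddCircle).toCircle : ℂ) =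
      ∏ i ∈ s, fourier (k i) (y i) := by
    intro s
    induction s using Finset.induction_on with
    | empty => simp
    | insert a s ha ih =>
      rw [Finset.sum_insert ha, Finset.prod_insert ha, AddCircle.toCircle_add, Circle.coe_mul, ih,
        fourier_apply]
  rw [h]
  rfl

theorem integral_mFourier_eq_one [Countable ι] (L : AddSubgroup (ι → UnitAddCircle))
    [CompactSpace L] {F : Finset ι} {k : F → ℤ}
    (hk : ∀ y ∈ L, ∑ i : F, k i • y i = 0) :
    ∫ y : L, mFourier k (fun i : F => y.1 i) ∂(subgroupHaar L) = 1 := by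
  have : ∀ y : L, mFourier k (fun i : F => y.1 i) = 1 := fun y => by
    rw [mFourier_apply_eq_toCircle, hk y y.2]
    simp
  simp [this]

theorem integral_mFourier_eq_zero [Countable ι] (L : AddSubgroup (ι → UnitAddCircle))
    [CompactSpace L] {F : Finset ι} {k : F → ℤ}
    (hk : ¬ ∀ y ∈ L, ∑ i : F, k i • y i = 0) :
    ∫ y : L, mFourier k (fun i : F => y.1 i) ∂(subgroupHaar L) = 0 := by
  push Not at hk
  obtain ⟨y₀, hy₀, hne⟩ := hk
  set χ : ℂ := ((∑ i : F, k i • y₀ i : UnitAddCircle).toCircle : ℂ) with hχ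
  have hχ1 : χ ≠ 1 := by
    intro h
    apply hne
    apply AddCircle.injective_toCircle one_ne_zero
    rw [AddCircle.toCircle_zero]
    exact Circle.coe_injective (by simpa [hχ] using h)
  have hshift : ∀ y : L, mFourier k (fun i : F => ((⟨y₀, hy₀⟩ : L) + y).1 i) =
      χ * mFourier k (fun i : F => y.1 i) := by
    intro y
    simp only [mFourier_apply_eq_toCircle, hχ, AddSubgroup.coe_add, Pi.add_apply, smul_add,
      Finset.sum_add_distrib, AddCircle.toCircle_add, Circle.coe_mul]
  have := integral_add_left_eq_self (μ := subgroupHaar L)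
    (fun y : L => mFourier k (fun i : F => y.1 i)) ⟨y₀, hy₀⟩
  simp only [hshift, integral_const_mul] at this
  have h0 : (χ - 1) * ∫ y : L, mFourier k (fun i : F => y.1 i) ∂(subgroupHaar L) = 0 := by
    rw [sub_mul, this]
    ring
  exact (mul_eq_zero.1 h0).resolve_left (sub_ne_zero.2 hχ1)

/-- Restriction of points of a subgroup of a torus to finitely many coordinates. -/
def restrictTorus (L : AddSubgroup (ι → UnitAddCircle)) (F : Finset ι) : C(L, UnitAddTorus F) :=
  ⟨fun y i => y.1 i, continuous_pi fun i => (continuous_apply i.1).comp continuous_subtype_val⟩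

theorem tendsto_integral_of_annihilators [Countable ι] {L : ℕ → AddSubgroup (ι → UnitAddCircle)}
    {M : AddSubgroup (ι → UnitAddCircle)} [∀ n, CompactSpace (L n)] [CompactSpace M]
    (hLM : ∀ n, L n ≤ M) {F : Finset ι}
    (hann : ∀ k : F → ℤ, ∀ᶠ n in atTop, (∀ y ∈ L n, ∑ i : F, k i • y i = 0) →
      ∀ y ∈ M, ∑ i : F, k i • y i = 0) (φ : C(UnitAddTorus F, ℂ)) :
    Tendsto (fun n => ∫ y, φ (restrictTorus (L n) F y) ∂(subgroupHaar (L n))) atTop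
      (𝓝 (∫ y, φ (restrictTorus M F y) ∂(subgroupHaar M))) := by
  have hint : ∀ (K : AddSubgroup (ι → UnitAddCircle)) [CompactSpace K] (ψ : C(UnitAddTorus F, ℂ)),
      Integrable (fun y => ψ (restrictTorus K F y)) (subgroupHaar K) := fun K _ ψ =>
    (ψ.continuous.comp (restrictTorus K F).continuous).integrable_of_hasCompactSupport
      (HasCompactSupport.of_compactSpace _)
  have hdist : ∀ (K : AddSubgroup (ι → UnitAddCircle)) [CompactSpace K]
      (ψ ψ' : C(UnitAddTorus F, ℂ)), dist (∫ y, ψ (restrictTorus K F y) ∂(subgroupHaar K))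
        (∫ y, ψ' (restrictTorus K F y) ∂(subgroupHaar K)) ≤ dist ψ ψ' := by
    intro K _ ψ ψ'
    rw [dist_eq_norm, ← integral_sub (hint K ψ) (hint K ψ')]
    refine (norm_integral_le_of_norm_le_const (C := dist ψ ψ') (ae_of_all _ fun y => ?_)).trans ?_
    · rw [← dist_eq_norm]
      exact ContinuousMap.dist_apply_le_dist _
    · simp
  have hφ : φ ∈ (Submodule.span ℂ (Set.range (mFourier (d := F)))).topologicalClosure := by
    rw [span_mFourier_closure_eq_top]
    trivial
  rw [Metric.tendsto_atTop]
  intro ε hε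
  obtain ⟨p, hp, hpε⟩ := Metric.mem_closure_iff.1 hφ (ε / 3) (by positivity)
  have hev : ∀ᶠ n in atTop, ∫ y, p (restrictTorus (L n) F y) ∂(subgroupHaar (L n)) =
      ∫ y, p (restrictTorus M F y) ∂(subgroupHaar M) := by
    clear hpε
    induction hp using Submodule.span_induction with
    | mem p hp =>
      obtain ⟨k, rfl⟩ := hp
      filter_upwards [hann k] with n hn
      by_cases hM : ∀ y ∈ M, ∑ i : F, k i • y i = 0
      · exact (integral_mFourier_eq_one (L n) fun y hy => hM y (hLM n hy)).trans
          (integral_mFourier_eq_one M hM).symm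
      · exact (integral_mFourier_eq_zero (L n) fun h => hM (hn h)).trans
          (integral_mFourier_eq_zero M hM).symm
    | zero => simp
    | add p q _ _ hp hq =>
      filter_upwards [hp, hq] with n hn hn'
      simp only [ContinuousMap.add_apply]
      rw [integral_add (hint _ p) (hint _ q), integral_add (hint _ p) (hint _ q), hn, hn']
    | smul c p _ hp =>
      filter_upwards [hp] with n hn
      simp only [ContinuousMap.smul_apply, integral_smul, hn]
  obtain ⟨n₀, hn₀⟩ := eventually_atTop.1 hev
  refine ⟨n₀, fun n hn => ?_⟩
  have h1 := hdist (L n) φ p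
  have h2 := hdist M p φ
  rw [dist_comm p φ] at h2
  rw [← hn₀ n hn] at h2
  have := dist_triangle (∫ y, φ (restrictTorus (L n) F y) ∂(subgroupHaar (L n)))
    (∫ y, p (restrictTorus (L n) F y) ∂(subgroupHaar (L n)))
    (∫ y, φ (restrictTorus M F y) ∂(subgroupHaar M))
  linarith

/-- Closed subgroups of a closed subgroup `M` of a torus, whose annihilators eventually exclude
each character that is nontrivial on `M`, eventually meet each open set that meets `M`. -/
theorem eventually_inter_nonempty_of_annihilators [Countable ι]
    {L : ℕ → AddSubgroup (ι → UnitAddCircle)} {M : AddSubgroup (ι → UnitAddCircle)}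
    [∀ n, CompactSpace (L n)] [CompactSpace M] (hLM : ∀ n, L n ≤ M)
    (hann : ∀ (F : Finset ι) (k : F → ℤ), ∀ᶠ n in atTop,
      (∀ y ∈ L n, ∑ i : F, k i • y i = 0) → ∀ y ∈ M, ∑ i : F, k i • y i = 0)
    {U : Set (ι → UnitAddCircle)} (hU : IsOpen U) {x : ι → UnitAddCircle} (hx : x ∈ M)
    (hxU : x ∈ U) : ∀ᶠ n in atTop, ∃ y ∈ L n, y ∈ U := by
  obtain ⟨F, V, hV, hVU⟩ := isOpen_pi_iff.1 hU x hxU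
  let W : Set (UnitAddTorus F) := Set.univ.pi fun i : F => V i
  have hWo : IsOpen W := isOpen_set_pi Set.finite_univ fun i _ => (hV i i.2).1
  have hxW : restrictTorus M F ⟨x, hx⟩ ∈ W := fun i _ => (hV i i.2).2
  have hWU : ∀ (K : AddSubgroup (ι → UnitAddCircle)) (y : K), restrictTorus K F y ∈ W → y.1 ∈ U :=
    fun K y hy => hVU fun i hi => hy ⟨i, hi⟩ trivial
  obtain ⟨ψ, hψ0, hψ1, hψ⟩ := exists_continuous_zero_one_of_isClosed hWo.isClosed_compl
    (isClosed_singleton (x := restrictTorus M F ⟨x, hx⟩))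
    (by simpa using hxW)
  have hpos : 0 < ∫ y, ψ (restrictTorus M F y) ∂(subgroupHaar M) := by
    have hc : Continuous fun y => ψ (restrictTorus M F y) :=
      ψ.continuous.comp (restrictTorus M F).continuous
    refine hc.integral_pos_of_hasCompactSupport_nonneg_nonzero
      (HasCompactSupport.of_compactSpace _) (fun y => (hψ _).1) (x := ⟨x, hx⟩) ?_
    rw [hψ1 rfl]
    simp
  let φ : C(UnitAddTorus F, ℂ) := ⟨fun z => (ψ z : ℂ), by fun_prop⟩
  have hlim := tendsto_integral_of_annihilators hLM (hann F) φ
  have hne : ∫ y, φ (restrictTorus M F y) ∂(subgroupHaar M) ≠ 0 := by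
    simp only [φ, ContinuousMap.coe_mk, integral_complex_ofReal]
    exact_mod_cast hpos.ne'
  filter_upwards [hlim.eventually_ne hne] with n hn
  by_contra! hcon
  apply hn
  have : ∀ y : L n, φ (restrictTorus (L n) F y) = 0 := by
    intro y
    have hy : restrictTorus (L n) F y ∈ Wᶜ := fun h => hcon y y.2 (hWU _ y h)
    simp [φ, hψ0 hy]
  simp [this]

theorem tendsto_hausdorffDist_univ {X : Type*} [MetricSpace X] [CompactSpace X] {A : ℕ → Set X}
    (hA : ∀ U : Set X, IsOpen U → U.Nonempty → ∀ᶠ n in atTop, ∃ y ∈ A n, y ∈ U) :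
    Tendsto (fun n => Metric.hausdorffDist (A n) Set.univ) atTop (𝓝 0) := by
  rw [Metric.tendsto_atTop]
  intro ε hε
  obtain ⟨t, ht, hcov⟩ := Metric.totallyBounded_iff.1
    (isCompact_univ (X := X)).totallyBounded (ε / 4) (by positivity)
  have hev : ∀ᶠ n in atTop, ∀ c ∈ t, ∃ y ∈ A n, y ∈ Metric.ball c (ε / 4) :=
    (eventually_all_finite ht).2 fun c _ =>
      hA _ Metric.isOpen_ball ⟨c, Metric.mem_ball_self (by positivity)⟩
  obtain ⟨n₀, hn₀⟩ := eventually_atTop.1 hev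
  refine ⟨n₀, fun n hn => ?_⟩
  rw [Real.dist_0_eq_abs, abs_of_nonneg Metric.hausdorffDist_nonneg]
  refine lt_of_le_of_lt (Metric.hausdorffDist_le_of_mem_dist (r := ε / 2) (by positivity)
    (fun y _ => ⟨y, trivial, by rw [dist_self]; positivity⟩) fun y _ => ?_) (by linarith)
  obtain ⟨c, hc, hyc⟩ := Set.mem_iUnion₂.1 (hcov (Set.mem_univ y))
  obtain ⟨z, hz, hzc⟩ := hn₀ n hn c hc
  refine ⟨z, hz, ?_⟩
  have := dist_triangle_right y z c
  rw [Metric.mem_ball] at hyc hzc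
  linarith

end HausdorffConvergence

section HarmonicModel

variable {G : Type*} [Group G] {f : G → ℤ}

theorem WellBalancedZ.isLaplacianOn (hf : WellBalancedZ f) :
    ∃ S : Finset G, IsLaplacianOn f S ∧ ∀ g : G, ∃ j, g ∈ (S : Set G) ^ j := by
  classical
  obtain ⟨hfin, hsum, hneg, hsymm, hgen⟩ := hf
  let S : Finset G := insert 1 hfin.toFinset
  have hS : IsLaplacianOn f S := by
    refine ⟨by simp [S], fun s hs h1 => ?_, fun s hs => ?_, ?_, hsymm⟩
    · have : f s ≠ 0 := by simpa [S, h1] using hs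
      exact lt_of_le_of_ne (hneg s h1) this
    · by_contra h
      exact hs (by simp [S, h])
    · rw [← hsum]
      refine (finsum_eq_sum_of_support_subset _ fun s hs => ?_).symm
      simp [S, Function.mem_support.1 hs]
  refine ⟨S, hS, fun g => ?_⟩
  have hg : g ∈ Subgroup.closure (Function.support f) := hgen ▸ Subgroup.mem_top g
  induction hg using Subgroup.closure_induction with
  | mem s hs => exact ⟨1, by simpa [S] using Or.inr hs⟩
  | one => exact ⟨0, by simp⟩
  | mul a b _ _ ha hb =>
    obtain ⟨i, hi⟩ := ha
    obtain ⟨j, hj⟩ := hb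
    exact ⟨i + j, by rw [pow_add]; exact Set.mul_mem_mul hi hj⟩
  | inv a _ ha =>
    obtain ⟨i, hi⟩ := ha
    exact ⟨i, inv_mem_pow_of_symmetric (fun s hs => hS.inv_mem hs) hi⟩

theorem IsLaplacianOn.mem_XfSet_iff {S : Finset G} (hS : IsLaplacianOn f S)
    {x : G → UnitAddCircle} : x ∈ XfSet f ↔ ∀ t, ∑ s ∈ S, f s • x (t * s) = 0 := by
  refine forall_congr' fun t => ?_
  rw [finsum_eq_sum_of_support_subset]
  intro s hs
  by_contra h
  exact hs (by simp [hS.eq_zero_of_notMem s h])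

/-- `X_f` as a subgroup of the torus. -/
def harmonicSubgroup (f : G → ℤ) (S : Finset G) : AddSubgroup (G → UnitAddCircle) where
  carrier := {x | ∀ t, ∑ s ∈ S, f s • x (t * s) = 0}
  zero_mem' := by simp
  add_mem' := fun {x y} hx hy t => by
    simp only [Pi.add_apply, smul_add, Finset.sum_add_distrib, hx t, hy t, add_zero]
  neg_mem' := fun {x} hx t => by
    simp only [Pi.neg_apply, smul_neg, Finset.sum_neg_distrib, hx t, neg_zero]

/-- `Fix_N(X_f)` as a subgroup of the torus. -/
def fixedHarmonicSubgroup (f : G → ℤ) (S : Finset G) (N : Subgroup G) :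
    AddSubgroup (G → UnitAddCircle) where
  carrier := {x | x ∈ harmonicSubgroup f S ∧ ∀ γ ∈ N, ∀ t : G, x (γ * t) = x t}
  zero_mem' := ⟨zero_mem _, by simp⟩
  add_mem' := fun hx hy => ⟨add_mem hx.1 hy.1, fun γ hγ t => by
    simp only [Pi.add_apply, hx.2 γ hγ t, hy.2 γ hγ t]⟩
  neg_mem' := fun hx => ⟨neg_mem hx.1, fun γ hγ t => by
    simp only [Pi.neg_apply, hx.2 γ hγ t]⟩

theorem isClosed_harmonicSubgroup (f : G → ℤ) (S : Finset G) :
    IsClosed (harmonicSubgroup f S : Set (G → UnitAddCircle)) := by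
  change IsClosed {x : G → UnitAddCircle | ∀ t, ∑ s ∈ S, f s • x (t * s) = 0}
  simp only [Set.ofPred_forall]
  exact isClosed_iInter fun t => isClosed_eq (by fun_prop) continuous_const

theorem isClosed_fixedHarmonicSubgroup (f : G → ℤ) (S : Finset G) (N : Subgroup G) :
    IsClosed (fixedHarmonicSubgroup f S N : Set (G → UnitAddCircle)) := by
  refine (isClosed_harmonicSubgroup f S).inter
    (s₂ := {x : G → UnitAddCircle | ∀ γ ∈ N, ∀ t : G, x (γ * t) = x t}) ?_
  simp only [Set.ofPred_forall]
  exact isClosed_iInter fun γ => isClosed_iInter fun _ => isClosed_iInter fun t =>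
    isClosed_eq (by fun_prop) (by fun_prop)

theorem eventually_injOn_mk {N : ℕ → Subgroup G} [∀ n, (N n).Normal]
    (hconv : (⋂ n : ℕ, ⋃ i : ℕ, ⋃ (_ : n ≤ i), ((N i : Set G))) = {1}) {E : Set G}
    (hE : E.Finite) : ∀ᶠ n in atTop, Set.InjOn (QuotientGroup.mk' (N n)) E := by
  have hev : ∀ g : G, g ≠ 1 → ∀ᶠ n in atTop, g ∉ N n := by
    intro g hg
    have : g ∉ ⋂ n : ℕ, ⋃ i : ℕ, ⋃ (_ : n ≤ i), ((N i : Set G)) := by rw [hconv]; exact hg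
    simp only [Set.mem_iInter, Set.mem_iUnion, not_forall, not_exists] at this
    obtain ⟨n, hn⟩ := this
    exact eventually_atTop.2 ⟨n, fun i hi => hn i hi⟩
  have hall : ∀ᶠ n in atTop, ∀ a ∈ E, ∀ b ∈ E, a ≠ b → a⁻¹ * b ∉ N n := by
    refine (eventually_all_finite hE).2 fun a _ => (eventually_all_finite hE).2 fun b _ => ?_
    by_cases h : a = b
    · simp [h]
    · filter_upwards [hev (a⁻¹ * b) fun h' => h (inv_mul_eq_one.1 h')] with n hn _ using hn
  filter_upwards [hall] with n hn a ha b hb hab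
  by_contra hne
  exact hn a ha b hb hne (QuotientGroup.eq.1 hab)

/-- A character that is nontrivial on `X_f` is eventually nontrivial on `Fix_{N n}(X_f)`. -/
theorem IsLaplacianOn.eventually_annihilator {S : Finset G} (hS : IsLaplacianOn f S)
    (hgen : ∀ g : G, ∃ j, g ∈ (S : Set G) ^ j) {N : ℕ → Subgroup G} [∀ n, (N n).Normal]
    [∀ n, (N n).FiniteIndex]
    (hconv : (⋂ n : ℕ, ⋃ i : ℕ, ⋃ (_ : n ≤ i), ((N i : Set G))) = {1})
    (F : Finset G) (k : F → ℤ) : ∀ᶠ n in atTop,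
      (∀ y ∈ fixedHarmonicSubgroup f S (N n), ∑ i : F, k i • y i = 0) →
        ∀ y ∈ harmonicSubgroup f S, ∑ i : F, k i • y i = 0 := by
  classical
  let k' : G → ℤ := fun t => if h : t ∈ F then k ⟨t, h⟩ else 0
  have hk' : ∀ y : G → UnitAddCircle, ∑ i : F, k i • y i = ∑ t ∈ F, k' t • y t := by
    intro y
    rw [← Finset.sum_coe_sort F]
    exact Finset.sum_congr rfl fun i _ => by simp [k']
  have h1 : (1 : G) ∈ (S : Set G) := hS.one_mem
  choose j hj using hgen
  let r := F.sup j
  have hF : ∀ t ∈ F, t ∈ (S : Set G) ^ r := fun t ht =>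
    Set.pow_subset_pow_right h1 (Finset.le_sup ht) (hj t)
  let R : ℕ := (r + 2 * r * (2 * (∑ t ∈ F, |k' t|) * r) : ℤ).toNat
  have hfinite : ((S : Set G) ^ (R + R + 2)).Finite := by
    rw [← Finset.coe_pow]
    exact Finset.finite_toSet _
  filter_upwards [eventually_injOn_mk hconv hfinite] with n hinj hann y hy
  rw [hk']
  refine hS.sum_smul_eq_zero_of_quotient (fun g => ⟨j g, hj g⟩)
    (QuotientGroup.mk'_surjective (N n)) hF (Int.self_le_toNat _) hinj (fun z hz => ?_) hy
  rw [← hk' fun t => z (QuotientGroup.mk' (N n) t)]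
  refine hann (fun t => z (QuotientGroup.mk' (N n) t))
    ⟨fun t => by simpa using hz (QuotientGroup.mk' (N n) t), fun γ hγ t => ?_⟩
  beta_reduce
  rw [map_mul, show QuotientGroup.mk' (N n) γ = 1 from (QuotientGroup.eq_one_iff γ).2 hγ, one_mul]

end HarmonicModel

/-- `Fix_{Γ_n}(X_f) → X_f` in the Hausdorff distance with respect to any metric on
`X_f` compatible with its (compact metrizable, subspace) topology. -/
theorem stmt9 {G : Type*} [Group G] [Countable G] [Infinite G]
    (f : G → ℤ) (hf : WellBalancedZ f)
    (N : ℕ → Subgroup G) (hnorm : ∀ n, (N n).Normal) (hfin : ∀ n, (N n).FiniteIndex)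
    (hconv : (⋂ n : ℕ, ⋃ i : ℕ, ⋃ (_ : n ≤ i), ((N i : Set G))) = {1}) :
    ∀ m : MetricSpace {x : G → UnitAddCircle // x ∈ XfSet f},
      m.toUniformSpace.toTopologicalSpace =
        (inferInstance : TopologicalSpace {x : G → UnitAddCircle // x ∈ XfSet f}) →
      Tendsto
        (fun n : ℕ => @Metric.hausdorffDist _ m.toPseudoMetricSpace
          {y : {x : G → UnitAddCircle // x ∈ XfSet f} | (y : G → UnitAddCircle) ∈ fixSet f (N n)}
          Set.univ)
        atTop (𝓝 0) := by
  intro m hm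
  obtain ⟨S, hS, hgen⟩ := hf.isLaplacianOn
  have hX : XfSet f = harmonicSubgroup f S := Set.ext fun x => hS.mem_XfSet_iff
  have hclosed : IsClosed (XfSet f) := hX ▸ isClosed_harmonicSubgroup f S
  have : CompactSpace (harmonicSubgroup f S) :=
    isCompact_iff_compactSpace.1 (isClosed_harmonicSubgroup f S).isCompact
  have (n : ℕ) : CompactSpace (fixedHarmonicSubgroup f S (N n)) :=
    isCompact_iff_compactSpace.1 (isClosed_fixedHarmonicSubgroup f S (N n)).isCompact
  have hcompact : @CompactSpace {x : G → UnitAddCircle // x ∈ XfSet f}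
      m.toUniformSpace.toTopologicalSpace := by
    rw [hm]
    exact isCompact_iff_compactSpace.1 hclosed.isCompact
  refine @tendsto_hausdorffDist_univ _ m hcompact _ fun U hU hUne => ?_
  rw [hm] at hU
  obtain ⟨V, hV, rfl⟩ := isOpen_induced_iff.1 hU
  obtain ⟨⟨x, hx⟩, hxV⟩ := hUne
  filter_upwards [eventually_inter_nonempty_of_annihilators
    (L := fun n => fixedHarmonicSubgroup f S (N n)) (fun n y hy => hy.1)
    (hS.eventually_annihilator hgen hconv) hV (hS.mem_XfSet_iff.1 hx) hxV] with n hn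
  obtain ⟨y, hy, hyV⟩ := hn
  have hyX : y ∈ XfSet f := hS.mem_XfSet_iff.2 hy.1
  exact ⟨⟨y, hyX⟩, ⟨hyX, hy.2⟩, hyV⟩
end
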